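/- Let (X, μ) and (X', μ') be σ-finite measure spaces, let p' : X × X' → ℝ≥0 and q' : X' → ℝ≥0 be measurable, let v' : X × X' → EuclideanSpace ℝ (Fin n) and u : X → EuclideanSpace ℝ (Fin n) be measurable, and assume the function (x, x') ↦ ‖u x‖ * ‖v' (x, x')‖ * p' (x, x') * q' x' is integrable on X × X'. Define p(x) := ∫ p'(x, x') q'(x') dμ'(x') and assume p(x) > 0 for μ-a.e. x, and define v(x) := (∫ v'(x, x') p'(x, x') q'(x') dμ'(x')) / p(x). Then ∫ ⟪u x, v x⟫ * p(x) dμ(x) = ∫∫ ⟪u x, v'(x, x')⟫ * p'(x, x') * q'(x') dμ'(x') dμ(x). -/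

import Mathlib

open MeasureTheory
open scoped RealInnerProductSpace NNReal

/-- The key Fubini step behind the FM/CFM gradient equivalence: pairing a test
field `u` against the marginal vector field `v = (∫ v' p' q' dμ')/p` weighted by
the marginal density `p = ∫ p' q' dμ'` equals the double integral of the pairing
against the conditional quantities. -/
theorem stmt_14 (n : ℕ) {X X' : Type*} [MeasurableSpace X] [MeasurableSpace X']
    (μ : Measure X) (μ' : Measure X') [SigmaFinite μ] [SigmaFinite μ']
    (p' : X × X' → ℝ≥0) (q' : X' → ℝ≥0) (hp' : Measurable p') (hq' : Measurable q')
    (v' : X × X' → EuclideanSpace ℝ (Fin n)) (u : X → EuclideanSpace ℝ (Fin n))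
    (hv' : Measurable v') (hu : Measurable u)
    (hint : Integrable
      (fun y : X × X' => ‖u y.1‖ * ‖v' y‖ * (p' y : ℝ) * (q' y.2 : ℝ)) (μ.prod μ'))
    (p : X → ℝ) (hp : ∀ x, p x = ∫ x', (p' (x, x') : ℝ) * (q' x' : ℝ) ∂μ')
    (hppos : ∀ᵐ x ∂μ, 0 < p x)
    (v : X → EuclideanSpace ℝ (Fin n))
    (hv : ∀ x, v x = (p x)⁻¹ • ∫ x', ((p' (x, x') : ℝ) * (q' x' : ℝ)) • v' (x, x') ∂μ') :
    ∫ x, ⟪u x, v x⟫ * p x ∂μ =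
      ∫ x, ∫ x', ⟪u x, v' (x, x')⟫ * (p' (x, x') : ℝ) * (q' x' : ℝ) ∂μ' ∂μ := by
  refine integral_congr_ae ?_
  filter_upwards [hppos, hint.prod_right_ae] with x hpx hx
  by_cases hux : u x = 0
  · simp [hux]
  have hsec : Integrable (fun x' => ((p' (x, x') : ℝ) * (q' x' : ℝ)) • v' (x, x')) μ' := by
    have hmeas : AEStronglyMeasurable
        (fun x' => ((p' (x, x') : ℝ) * (q' x' : ℝ)) • v' (x, x')) μ' := by
      refine Measurable.aestronglyMeasurable ?_
      fun_prop
    refine (hx.const_mul ‖u x‖⁻¹).mono' hmeas (Filter.Eventually.of_forall fun x' => ?_)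
    have hnorm : ‖u x‖ ≠ 0 := norm_ne_zero_iff.mpr hux
    rw [norm_smul, Real.norm_of_nonneg (by positivity)]
    field_simp
    exact le_rfl
  rw [hv, real_inner_smul_right, mul_right_comm, inv_mul_cancel₀ hpx.ne', one_mul,
    ← integral_inner hsec]
  refine integral_congr_ae (Filter.Eventually.of_forall fun x' => ?_)
  simp only [real_inner_smul_right]
  ring
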